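/- Fix a positive integer k and positive integers b₁, …, b_k, and let S = Σ_{i=1}^{k} b_i. The diagonal quadratic form Q(x₁,…,x_k) = Σ_{i=1}^{k} b_i · x_i², with all x_i restricted to odd integers, represents every integer of the form 8n + S (n ∈ ℕ) if and only if it represents each of 8 + S, 16 + S, 32 + S, 40 + S, and 64 + S. -/

import Mathlib

/-- The ternary quadratic form `a x² + b y² + c z² + 2 r y z + 2 s x z + 2 t x y`. -/
structure TernaryForm where
  (a b c r s t : ℤ)

namespace TernaryForm

def eval (f : TernaryForm) (x y z : ℤ) : ℤ :=
  f.a * x ^ 2 + f.b * y ^ 2 + f.c * z ^ 2 + 2 * f.r * y * z + 2 * f.s * x * z + 2 * f.t * x * y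

/-- The leading `2 × 2` minor of the Gram matrix. -/
def minor (f : TernaryForm) : ℤ := f.a * f.b - f.t ^ 2

/-- The determinant of the Gram matrix. -/
def det (f : TernaryForm) : ℤ :=
  f.a * f.b * f.c + 2 * f.r * f.s * f.t - f.a * f.r ^ 2 - f.b * f.s ^ 2 - f.c * f.t ^ 2

/-- Positive definite ternary forms of determinant `D` representing `N`. -/
def posDefRepresenting (D N : ℤ) : Set TernaryForm :=
  {f | 0 < f.a ∧ 0 < f.minor ∧ f.det = D ∧ ∃ x y z, f.eval x y z = N}

/-- The form in the basis `k e₁ + e₂, e₁, e₃`. -/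
def swapXY (f : TernaryForm) (k : ℤ) : TernaryForm where
  a := k ^ 2 * f.a + 2 * k * f.t + f.b
  b := f.a
  c := f.c
  r := f.s
  s := k * f.s + f.r
  t := k * f.a + f.t

/-- The form in the basis `e₁, k e₂ + e₃, e₂`. -/
def swapYZ (f : TernaryForm) (k : ℤ) : TernaryForm where
  a := f.a
  b := k ^ 2 * f.b + 2 * k * f.r + f.c
  c := f.b
  r := k * f.b + f.r
  s := f.t
  t := k * f.t + f.s

lemma swapXY_mem {D N : ℤ} {f : TernaryForm} (hf : f ∈ posDefRepresenting D N) (k : ℤ) :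
    f.swapXY k ∈ posDefRepresenting D N := by
  obtain ⟨ha, hm, hd, x, y, z, h⟩ := hf
  have hmin : (f.swapXY k).minor = f.minor := by
    simp only [minor, swapXY]; ring
  refine ⟨?_, hmin ▸ hm, ?_, y, x - k * y, z, ?_⟩
  · have : f.a * (f.swapXY k).a = f.minor + (f.t + k * f.a) ^ 2 := by
      simp only [minor, swapXY]; ring
    exact pos_of_mul_pos_right (by rw [this]; positivity) ha.le
  · rw [← hd]; simp only [det, swapXY]; ring
  · rw [← h]; simp only [eval, swapXY]; ring

lemma swapYZ_minor (f : TernaryForm) (k : ℤ) : (f.swapYZ k).minor =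
    (f.a * f.c - f.s ^ 2) + 2 * k * (f.a * f.r - f.s * f.t) + k ^ 2 * f.minor := by
  simp only [minor, swapYZ]; ring

lemma swapYZ_mem {D N : ℤ} (hD : 0 < D) {f : TernaryForm} (hf : f ∈ posDefRepresenting D N)
    (k : ℤ) : f.swapYZ k ∈ posDefRepresenting D N := by
  obtain ⟨ha, hm, hd, x, y, z, h⟩ := hf
  refine ⟨ha, ?_, ?_, x, z, y - k * z, ?_⟩
  · have : f.minor * (f.swapYZ k).minor =
        f.a * D + (f.a * f.r - f.s * f.t + k * f.minor) ^ 2 := by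
      rw [← hd]; simp only [minor, swapYZ, det]; ring
    exact pos_of_mul_pos_right (by rw [this]; positivity) hm.le
  · rw [← hd]; simp only [det, swapYZ]; ring
  · rw [← h]; simp only [eval, swapYZ]; ring

lemma exists_minimal_mem {D N : ℤ} (h : (posDefRepresenting D N).Nonempty) :
    ∃ f ∈ posDefRepresenting D N, ∀ g ∈ posDefRepresenting D N,
      f.a ≤ g.a ∧ (g.a = f.a → f.minor ≤ g.minor) := by
  obtain ⟨f, hf, hmin⟩ := (InvImage.wf (fun f : TernaryForm ↦ toLex (f.a.toNat, f.minor.toNat))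
    wellFounded_lt).has_min _ h
  refine ⟨f, hf, fun g hg ↦ ?_⟩
  have := hmin g hg
  simp only [InvImage, Prod.Lex.toLex_lt_toLex] at this
  have h1 := hf.1
  have h2 := hf.2.1
  have h3 := hg.1
  have h4 := hg.2.1
  omega

end TernaryForm

lemma exists_two_mul_abs_add_mul_le {a : ℤ} (ha : 0 < a) (t : ℤ) :
    ∃ k : ℤ, 2 * |t + k * a| ≤ a := by
  refine ⟨-((2 * t + a) / (2 * a)), ?_⟩
  have h1 := Int.mul_ediv_add_emod (2 * t + a) (2 * a)
  have h2 := Int.emod_nonneg (2 * t + a) (b := 2 * a) (by omega)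
  have h3 := Int.emod_lt_of_pos (2 * t + a) (b := 2 * a) (by omega)
  have h4 : 2 * |t + -((2 * t + a) / (2 * a)) * a| =
      |2 * t - 2 * a * ((2 * t + a) / (2 * a))| := by
    rw [← abs_two (α := ℤ), ← abs_mul, abs_two]; ring_nf
  rw [h4, abs_le]
  constructor <;> linarith

/-- The minimum `a` of a binary form of determinant `a b - t ^ 2` satisfies Hermite's bound. -/
lemma three_mul_sq_le_of_forall_le {a b t : ℤ} (ha : 0 < a)
    (h : ∀ k : ℤ, a ≤ b + 2 * k * t + k ^ 2 * a) : 3 * a ^ 2 ≤ 4 * (a * b - t ^ 2) := by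
  obtain ⟨k, hk⟩ := exists_two_mul_abs_add_mul_le ha t
  have h1 : (2 * |t + k * a|) ^ 2 ≤ a ^ 2 := by gcongr
  rw [mul_pow, sq_abs] at h1
  have h2 : a * a ≤ a * (b + 2 * k * t + k ^ 2 * a) := by gcongr; exact h k
  nlinarith

namespace TernaryForm

/-- A positive definite ternary form of determinant at most `3` splits off a unit vector. -/
lemma exists_eq_sq_add_binary {D N : ℤ} (hD : 0 < D) (hD3 : D ≤ 3)
    (h : (posDefRepresenting D N).Nonempty) :
    ∃ m e c : ℤ, 0 < m ∧ 3 * m ^ 2 ≤ 4 * D ∧ m * c - e ^ 2 = D ∧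
      ∃ x y z, N = x ^ 2 + m * y ^ 2 + 2 * e * y * z + c * z ^ 2 := by
  obtain ⟨f, hf, hmin⟩ := exists_minimal_mem h
  obtain ⟨ha, hm, hd, x, y, z, hN⟩ := id hf
  have h1 : 3 * f.a ^ 2 ≤ 4 * f.minor := three_mul_sq_le_of_forall_le ha fun k ↦ by
    have := (hmin _ (swapXY_mem hf k)).1
    simp only [swapXY] at this
    linarith
  have hdet : f.minor * (f.a * f.c - f.s ^ 2) - (f.a * f.r - f.s * f.t) ^ 2 = f.a * D := by
    rw [← hd]; simp only [minor, det]; ring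
  have h2 : 3 * f.minor ^ 2 ≤ 4 * (f.a * D) := hdet ▸ three_mul_sq_le_of_forall_le hm fun k ↦ by
    have := (hmin _ (swapYZ_mem hD hf k)).2 rfl
    rwa [swapYZ_minor] at this
  have ha1 : f.a = 1 := by
    by_contra hne
    have h3 : 2 ≤ f.a := by omega
    have h4 : f.a * D ≤ f.a * 3 := by gcongr
    have h5 : (3 * f.a ^ 2) ^ 2 ≤ (4 * f.minor) ^ 2 := by gcongr
    have h6 : 2 ^ 3 ≤ f.a ^ 3 := by gcongr
    nlinarith
  rw [ha1, one_mul] at h2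
  rw [ha1, one_mul D] at hdet
  refine ⟨f.minor, _, _, hm, h2, hdet, x + f.t * y + f.s * z, y, z, ?_⟩
  rw [← hN]
  simp only [eval, minor, ha1]
  ring

lemma exists_sq_add_sq_add_sq {N : ℤ} (h : (posDefRepresenting 1 N).Nonempty) :
    ∃ x y z, N = x ^ 2 + y ^ 2 + z ^ 2 := by
  obtain ⟨m, e, c, hm, hm2, hdet, x, y, z, rfl⟩ :=
    exists_eq_sq_add_binary one_pos (by norm_num) h
  obtain rfl : m = 1 := by nlinarith
  obtain rfl : c = 1 + e ^ 2 := by linarith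
  exact ⟨x, y + e * z, z, by ring⟩

lemma exists_of_det_three {N : ℤ} (h : (posDefRepresenting 3 N).Nonempty) :
    ∃ x y z, N = x ^ 2 + y ^ 2 + 3 * z ^ 2 ∨ N = x ^ 2 + 2 * (y ^ 2 + y * z + z ^ 2) := by
  obtain ⟨m, e, c, hm, hm2, hdet, x, y, z, rfl⟩ :=
    exists_eq_sq_add_binary three_pos le_rfl h
  have hm3 : m ≤ 2 := by nlinarith
  obtain rfl | rfl : m = 1 ∨ m = 2 := by omega
  · obtain rfl : c = 3 + e ^ 2 := by linarith
    exact ⟨x, y + e * z, z, Or.inl (by ring)⟩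
  · have he : Odd e := by
      have : Odd (e ^ 2) := ⟨c - 2, by linarith⟩
      exact Int.odd_pow.1 this |>.resolve_right (by norm_num)
    obtain ⟨k, rfl⟩ := he
    obtain rfl : c = 2 * k ^ 2 + 2 * k + 2 := by linarith
    exact ⟨x, y + k * z, z, Or.inr (by ring)⟩

/-- If `-d` is a square modulo `d N - D`, some positive form of determinant `D` represents `N`. -/
lemma nonempty_posDefRepresenting {D N d t : ℤ} (hd : 0 < d) (hb : 0 < d * N - D)
    (h : d * N - D ∣ t ^ 2 + d) : (posDefRepresenting D N).Nonempty := by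
  obtain ⟨a, ha⟩ := h
  refine ⟨⟨a, d * N - D, N, 0, 1, t⟩, ?_, ?_, ?_, 0, 0, 1, ?_⟩
  · exact pos_of_mul_pos_right (by rw [← ha]; positivity) hb.le
  · simp only [minor]; linarith
  · simp only [det]
    linear_combination (-N) * ha
  · simp [eval]

end TernaryForm

section Dirichlet

open NumberTheorySymbols

lemma exists_prime_eq_mul_add {M r : ℕ} (hM : 0 < M) (h : r.Coprime M) :
    ∃ j p : ℕ, 0 < j ∧ p.Prime ∧ p = M * j + r := by
  have : NeZero M := ⟨hM.ne'⟩
  obtain ⟨p, hp, hprime, heq⟩ := Nat.forall_exists_prime_gt_and_eq_mod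
    ((ZMod.isUnit_iff_coprime r M).2 h) r
  rw [eq_comm, ZMod.natCast_eq_natCast_iff, Nat.modEq_iff_dvd' hp.le] at heq
  obtain ⟨j, hj⟩ := heq
  refine ⟨j, p, Nat.pos_of_ne_zero ?_, hprime, by omega⟩
  rintro rfl
  omega

lemma exists_dvd_sq_add_of_jacobiSym_eq_one {p : ℕ} (hp : p.Prime) {d : ℤ}
    (h : J(-d | p) = 1) : ∃ t : ℤ, (p : ℤ) ∣ t ^ 2 + d := by
  have : Fact p.Prime := ⟨hp⟩
  obtain ⟨x, hx⟩ := ZMod.isSquare_of_jacobiSym_eq_one h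
  obtain ⟨t, rfl⟩ := ZMod.intCast_surjective x
  refine ⟨t, (ZMod.intCast_zmod_eq_zero_iff_dvd _ p).1 ?_⟩
  push_cast at hx ⊢
  linear_combination -hx

lemma exists_two_mul_dvd_sq_add_of_jacobiSym_eq_one {p : ℕ} (hp : p.Prime) (hp2 : Odd p) {d : ℤ}
    (hd : Odd d) (h : J(-d | p) = 1) : ∃ t : ℤ, 2 * (p : ℤ) ∣ t ^ 2 + d := by
  obtain ⟨t, ht⟩ := exists_dvd_sq_add_of_jacobiSym_eq_one hp h
  obtain ⟨t, hto, ht⟩ : ∃ t : ℤ, Odd t ∧ (p : ℤ) ∣ t ^ 2 + d := by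
    obtain he | ho := Int.even_or_odd t
    · refine ⟨t + p, he.add_odd (by exact_mod_cast hp2), ?_⟩
      have : (t + p) ^ 2 + d = t ^ 2 + d + p * (2 * t + p) := by ring
      rw [this]
      exact dvd_add ht (dvd_mul_right _ _)
    · exact ⟨t, ho, ht⟩
  refine ⟨t, IsCoprime.mul_dvd ?_ ?_ ht⟩
  · rw [← Nat.cast_two, Nat.isCoprime_iff_coprime]
    exact (Nat.coprime_two_left).2 hp2
  · exact (hto.pow.add_odd hd).two_dvd

lemma exists_sq_add_sq_add_sq_of_mod_four_eq_two {N : ℕ} (hN : N % 4 = 2) :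
    ∃ x y z : ℤ, (N : ℤ) = x ^ 2 + y ^ 2 + z ^ 2 := by
  have hcop : (N - 1).Coprime (4 * N) := by
    refine Nat.Coprime.mul_right ?_ ?_
    · rw [show 4 = 2 ^ 2 by norm_num]
      exact Nat.Coprime.pow_right _ (Nat.coprime_two_right.2 (Nat.odd_iff.2 (by omega)))
    · exact ((Nat.coprime_self_sub_right (by omega)).2 (Nat.coprime_one_right N)).symm
  obtain ⟨j, p, hj, hp, hpj⟩ := exists_prime_eq_mul_add (by omega) hcop
  have hpd : (p : ℤ) = ((4 * j + 1 : ℕ) : ℤ) * N - 1 := by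
    rw [hpj]; push_cast [show 1 ≤ N by omega]; ring
  have hp4 : p % 4 = 1 := by
    rw [hpj, mul_assoc]; omega
  have hJ : J(-((4 * j + 1 : ℕ) : ℤ) | p) = 1 := by
    have hpo : Odd p := Nat.odd_iff.2 (by omega)
    have hdo : Odd (4 * j + 1) := Nat.odd_iff.2 (by omega)
    rw [jacobiSym.neg _ hpo, ZMod.χ₄_nat_one_mod_four hp4, one_mul,
      jacobiSym.quadratic_reciprocity_one_mod_four (by omega) hpo,
      jacobiSym.mod_left' (a₂ := -1), jacobiSym.at_neg_one hdo,
      ZMod.χ₄_nat_one_mod_four (by omega)]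
    rw [hpd]
    apply Int.ModEq.symm
    rw [Int.modEq_iff_dvd]
    exact ⟨N, by ring⟩
  obtain ⟨t, ht⟩ := exists_dvd_sq_add_of_jacobiSym_eq_one hp hJ
  rw [hpd] at ht
  refine TernaryForm.exists_sq_add_sq_add_sq
    (TernaryForm.nonempty_posDefRepresenting (by positivity) ?_ ht)
  rw [← hpd]
  exact_mod_cast hp.pos

/-- Common congruence computation for `2 p = d N - 1`. -/
lemma exists_sq_add_sq_add_sq_of_prime {N d p : ℕ} (hp : p.Prime) (hd : d % 2 = 1)
    (hpd : 2 * (p : ℤ) = (d : ℤ) * N - 1)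
    (h : d % 8 = 1 ∧ p % 4 = 1 ∨ d % 8 = 3 ∧ p % 2 = 1) :
    ∃ x y z : ℤ, (N : ℤ) = x ^ 2 + y ^ 2 + z ^ 2 := by
  have hpo : Odd p := Nat.odd_iff.2 (by omega)
  have hdo : Odd d := Nat.odd_iff.2 hd
  have h2p : J(2 | d) * J(p | d) = J(-1 | d) := by
    rw [← jacobiSym.mul_left, hpd]
    apply jacobiSym.mod_left'
    apply Int.ModEq.symm
    rw [Int.modEq_iff_dvd]
    exact ⟨N, by ring⟩
  rw [jacobiSym.at_two hdo, jacobiSym.at_neg_one hdo, ZMod.χ₈_nat_eq_if_mod_eight] at h2p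
  have hJ : J(-(d : ℤ) | p) = 1 := by
    rw [jacobiSym.neg _ hpo]
    rcases h with ⟨hd8, hp4⟩ | ⟨hd8, -⟩
    · rw [ZMod.χ₄_nat_one_mod_four (by omega)] at h2p
      rw [ZMod.χ₄_nat_one_mod_four hp4,
        jacobiSym.quadratic_reciprocity_one_mod_four (by omega) hpo]
      simpa [hd8, hd] using h2p
    · rw [ZMod.χ₄_nat_three_mod_four (by omega)] at h2p
      have hJp : J(p | d) = 1 := by simpa [hd8, hd] using h2p
      obtain hp4 | hp4 : p % 4 = 1 ∨ p % 4 = 3 := by have := Nat.odd_iff.1 hpo; omega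
      · rw [ZMod.χ₄_nat_one_mod_four hp4,
          jacobiSym.quadratic_reciprocity_one_mod_four' hdo hp4, hJp, one_mul]
      · rw [ZMod.χ₄_nat_three_mod_four hp4,
          jacobiSym.quadratic_reciprocity_three_mod_four (by omega) hp4, hJp]
        norm_num
  obtain ⟨t, ht⟩ := exists_two_mul_dvd_sq_add_of_jacobiSym_eq_one hp hpo
    (by exact_mod_cast hdo) hJ
  rw [hpd] at ht
  refine TernaryForm.exists_sq_add_sq_add_sq
    (TernaryForm.nonempty_posDefRepresenting (by have := hdo.pos; positivity) ?_ ht)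
  rw [← hpd]
  have := hp.pos
  positivity

lemma exists_sq_add_sq_add_sq_of_odd {N : ℕ} (hN : N % 2 = 1) (hN8 : N % 8 ≠ 7) :
    ∃ x y z : ℤ, (N : ℤ) = x ^ 2 + y ^ 2 + z ^ 2 := by
  obtain ⟨c, r, hc, hr⟩ : ∃ c r, (c = 1 ∧ N % 8 = 3 ∨ c = 3 ∧ N % 4 = 1) ∧ 2 * r + 1 = c * N := by
    obtain h | h : N % 8 = 3 ∨ N % 4 = 1 := by omega
    · exact ⟨1, (N - 1) / 2, Or.inl ⟨rfl, h⟩, by omega⟩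
    · exact ⟨3, (3 * N - 1) / 2, Or.inr ⟨rfl, h⟩, by omega⟩
  have hro : r % 2 = 1 := by rcases hc with ⟨rfl, h⟩ | ⟨rfl, h⟩ <;> omega
  have hcop : r.Coprime (4 * N) := by
    refine Nat.Coprime.mul_right ?_ ?_
    · rw [show 4 = 2 ^ 2 by norm_num]
      exact Nat.Coprime.pow_right _ (Nat.coprime_two_right.2 (Nat.odd_iff.2 hro))
    · rw [← Nat.isCoprime_iff_coprime]
      refine ⟨-2, c, ?_⟩
      zify at hr
      linarith
  obtain ⟨j, p, hj, hp, hpj⟩ := exists_prime_eq_mul_add (by omega) hcop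
  have hpr : p % 4 = r % 4 := by rw [hpj, mul_assoc]; omega
  refine exists_sq_add_sq_add_sq_of_prime (d := 8 * j + c) hp ?_ ?_ ?_
  · omega
  · zify at hpj hr
    push_cast
    linear_combination 2 * hpj + hr
  · rcases hc with ⟨rfl, h⟩ | ⟨rfl, h⟩ <;> omega

lemma jacobiSym_neg_three_eq_one {d : ℕ} (h : d % 24 = 1) : J(-3 | d) = 1 := by
  have hdo : Odd d := Nat.odd_iff.2 (by omega)
  rw [jacobiSym.neg _ hdo, ZMod.χ₄_nat_one_mod_four (by omega), one_mul,
    show (3 : ℤ) = ((3 : ℕ) : ℤ) by rfl,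
    jacobiSym.quadratic_reciprocity_one_mod_four' (by decide) (by omega),
    jacobiSym.mod_left' (a₂ := 1), jacobiSym.one_left]
  omega

lemma exists_sq_add_sq_add_three_mul_sq {N : ℕ} (hN : N % 8 = 5) (hN3 : N % 3 ≠ 0) :
    ∃ x y z : ℤ, (N : ℤ) = x ^ 2 + y ^ 2 + 3 * z ^ 2 := by
  obtain ⟨r, hr⟩ : ∃ r, 2 * r + 3 = N := ⟨(N - 3) / 2, by omega⟩
  have hr3 : r.Coprime 3 := ((Nat.Prime.coprime_iff_not_dvd Nat.prime_three).2 (by omega)).symm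
  have hcop : r.Coprime (3 * (4 * N)) := by
    refine hr3.mul_right (Nat.Coprime.mul_right ?_ ?_)
    · rw [show 4 = 2 ^ 2 by norm_num]
      exact Nat.Coprime.pow_right _ (Nat.coprime_two_right.2 (Nat.odd_iff.2 (by omega)))
    · rw [← hr]
      simpa using hr3
  obtain ⟨j, p, hj, hp, hpj⟩ := exists_prime_eq_mul_add (by omega) hcop
  have hp4 : p % 4 = 1 := by
    have : p = 4 * (3 * N * j) + r := by rw [hpj]; ring
    omega
  have hpo : Odd p := Nat.odd_iff.2 (by omega)
  obtain ⟨d, hd⟩ : ∃ d, d = 24 * j + 1 := ⟨_, rfl⟩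
  have hdo : Odd d := Nat.odd_iff.2 (by omega)
  have hpd : 2 * (p : ℤ) = (d : ℤ) * N - 3 := by
    zify at hpj hd hr
    linear_combination 2 * hpj - N * hd + hr
  have hJ : J(-(d : ℤ) | p) = 1 := by
    have h2p : J(2 | d) * J(p | d) = J(-3 | d) := by
      rw [← jacobiSym.mul_left, hpd]
      apply jacobiSym.mod_left'
      apply Int.ModEq.symm
      rw [Int.modEq_iff_dvd]
      exact ⟨N, by ring⟩
    rw [jacobiSym_neg_three_eq_one (by omega), jacobiSym.at_two hdo,
      ZMod.χ₈_nat_eq_if_mod_eight] at h2p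
    rw [jacobiSym.neg _ hpo, ZMod.χ₄_nat_one_mod_four hp4,
        jacobiSym.quadratic_reciprocity_one_mod_four (by omega) hpo]
    simpa [show d % 8 = 1 by omega, show d % 2 = 1 by omega] using h2p
  obtain ⟨t, ht⟩ := exists_two_mul_dvd_sq_add_of_jacobiSym_eq_one hp hpo
    (by exact_mod_cast hdo) hJ
  rw [hpd] at ht
  obtain ⟨x, y, z, h | h⟩ := TernaryForm.exists_of_det_three
    (TernaryForm.nonempty_posDefRepresenting (by have := hdo.pos; positivity)
      (by rw [← hpd]; have := hp.pos; positivity) ht)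
  · exact ⟨x, y, z, h⟩
  · exfalso
    have h8 := congrArg (fun n : ℤ ↦ (n : ZMod 8)) h
    have hN8 : ((N : ℤ) : ZMod 8) = 5 := by
      rw [Int.cast_natCast, ← ZMod.natCast_mod, hN]; rfl
    push_cast at h8 hN8
    rw [hN8] at h8
    generalize (x : ZMod 8) = x at h8
    generalize (y : ZMod 8) = y at h8
    generalize (z : ZMod 8) = z at h8
    revert x y z
    decide

end Dirichlet

section OddSquares

lemma Int.sq_emod_sixteen_cases (x : ℤ) :
    x % 2 = 1 ∧ x ^ 2 % 8 = 1 ∨ x % 4 = 2 ∧ x ^ 2 % 16 = 4 ∨ x % 4 = 0 ∧ x ^ 2 % 16 = 0 := by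
  obtain ⟨k, r, hr, rfl⟩ : ∃ k r : ℤ, (r = 0 ∨ r = 1 ∨ r = 2 ∨ r = 3) ∧ x = 4 * k + r :=
    ⟨x / 4, x % 4, by omega, by omega⟩
  rcases hr with rfl | rfl | rfl | rfl
  · exact Or.inr (Or.inr ⟨by omega, by ring_nf; omega⟩)
  · exact Or.inl ⟨by omega, by ring_nf; omega⟩
  · exact Or.inr (Or.inl ⟨by omega, by ring_nf; omega⟩)
  · exact Or.inl ⟨by omega, by ring_nf; omega⟩

lemma Int.sq_emod_three_cases (x : ℤ) :
    x % 3 = 0 ∧ x ^ 2 % 3 = 0 ∨ x % 3 ≠ 0 ∧ x ^ 2 % 3 = 1 := by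
  obtain ⟨k, r, hr, rfl⟩ : ∃ k r : ℤ, (r = 0 ∨ r = 1 ∨ r = 2) ∧ x = 3 * k + r :=
    ⟨x / 3, x % 3, by omega, by omega⟩
  rcases hr with rfl | rfl | rfl <;> ring_nf <;> omega

lemma Int.exists_sq_eq_and_emod_three_eq_one {x : ℤ} (hx : x % 3 ≠ 0) :
    ∃ y : ℤ, y ^ 2 = x ^ 2 ∧ y % 3 = 1 := by
  obtain h | h : x % 3 = 1 ∨ (-x) % 3 = 1 := by omega
  · exact ⟨x, rfl, h⟩
  · exact ⟨-x, by ring, h⟩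

lemma exists_odd_sq_add_odd_sq_add_four_mul_sq {N : ℕ} (hN : N % 4 = 2) :
    ∃ a b c : ℤ, Odd a ∧ Odd b ∧ (N : ℤ) = a ^ 2 + b ^ 2 + 4 * c ^ 2 := by
  obtain ⟨x, y, z, h⟩ := exists_sq_add_sq_add_sq_of_mod_four_eq_two hN
  simp only [Int.odd_iff]
  have hx := x.sq_emod_sixteen_cases
  have hy := y.sq_emod_sixteen_cases
  have hz := z.sq_emod_sixteen_cases
  obtain h' | h' | h' : (x % 2 = 0 ∧ y % 2 = 1 ∧ z % 2 = 1) ∨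
      (y % 2 = 0 ∧ x % 2 = 1 ∧ z % 2 = 1) ∨ (z % 2 = 0 ∧ x % 2 = 1 ∧ y % 2 = 1) := by omega
  · obtain ⟨c, rfl⟩ := Int.dvd_of_emod_eq_zero h'.1
    exact ⟨y, z, c, h'.2.1, h'.2.2, by rw [h]; ring⟩
  · obtain ⟨c, rfl⟩ := Int.dvd_of_emod_eq_zero h'.1
    exact ⟨x, z, c, h'.2.1, h'.2.2, by rw [h]; ring⟩
  · obtain ⟨c, rfl⟩ := Int.dvd_of_emod_eq_zero h'.1
    exact ⟨x, y, c, h'.2.1, h'.2.2, by rw [h]; ring⟩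

lemma exists_odd_sq_add_four_mul_sq_add_four_mul_sq {N : ℕ} (hN : N % 4 = 1) :
    ∃ a b c : ℤ, Odd a ∧ (N : ℤ) = a ^ 2 + 4 * b ^ 2 + 4 * c ^ 2 := by
  obtain ⟨x, y, z, h⟩ := exists_sq_add_sq_add_sq_of_odd (N := N) (by omega) (by omega)
  simp only [Int.odd_iff]
  have hx := x.sq_emod_sixteen_cases
  have hy := y.sq_emod_sixteen_cases
  have hz := z.sq_emod_sixteen_cases
  obtain ⟨h1, h2, h3⟩ | ⟨h1, h2, h3⟩ | ⟨h1, h2, h3⟩ : (x % 2 = 1 ∧ y % 2 = 0 ∧ z % 2 = 0) ∨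
      (y % 2 = 1 ∧ x % 2 = 0 ∧ z % 2 = 0) ∨ (z % 2 = 1 ∧ x % 2 = 0 ∧ y % 2 = 0) := by omega
  all_goals
    obtain ⟨b, rfl⟩ := Int.dvd_of_emod_eq_zero h2
    obtain ⟨c, rfl⟩ := Int.dvd_of_emod_eq_zero h3
    exact ⟨_, b, c, h1, by rw [h]; ring⟩

/-- Four times an odd value of `p² + p q + q²` has the form `x² + 3 z²` with `x`, `z` odd. -/
lemma exists_odd_sq_add_three_mul_sq {p q : ℤ} (h : Odd (p ^ 2 + p * q + q ^ 2)) :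
    ∃ x z : ℤ, Odd x ∧ Odd z ∧ x ^ 2 + 3 * z ^ 2 = 4 * (p ^ 2 + p * q + q ^ 2) := by
  by_cases hq : Odd q
  · exact ⟨2 * p + q, q, (even_two_mul p).add_odd hq, hq, by ring⟩
  · have hp : Odd p := by
      by_contra hp
      rw [Int.not_odd_iff_even] at hp hq
      exact Int.not_even_iff_odd.2 h (by simp [hp, hq, parity_simps])
    exact ⟨2 * q + p, p, (even_two_mul q).add_odd hp, hp, by ring⟩

/-- The form `a x² + b y² + c z²` with `x`, `y`, `z` odd represents `8 n + (a + b + c)`. -/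
def OddTernaryRepresents (a b c n : ℕ) : Prop :=
  ∃ x y z : ℤ, Odd x ∧ Odd y ∧ Odd z ∧ a * x ^ 2 + b * y ^ 2 + c * z ^ 2 = 8 * n + (a + b + c)

/-- The form `a x² + b y² + c z² + d w²` with all variables odd represents
`8 n + (a + b + c + d)`. -/
def OddQuaternaryRepresents (a b c d n : ℕ) : Prop :=
  ∃ x y z w : ℤ, Odd x ∧ Odd y ∧ Odd z ∧ Odd w ∧
    a * x ^ 2 + b * y ^ 2 + c * z ^ 2 + d * w ^ 2 = 8 * n + (a + b + c + d)

lemma oddTernaryRepresents_one_one_one (n : ℕ) : OddTernaryRepresents 1 1 1 n := by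
  obtain ⟨x, y, z, h⟩ := exists_sq_add_sq_add_sq_of_odd (N := 8 * n + 3) (by omega) (by omega)
  have hx := x.sq_emod_sixteen_cases
  have hy := y.sq_emod_sixteen_cases
  have hz := z.sq_emod_sixteen_cases
  push_cast at h
  refine ⟨x, y, z, ?_⟩
  simp only [Int.odd_iff]
  push_cast
  omega

lemma oddTernaryRepresents_one_one_two (n : ℕ) : OddTernaryRepresents 1 1 2 n := by
  obtain ⟨a, b, c, ha, hb, h⟩ :=
    exists_odd_sq_add_odd_sq_add_four_mul_sq (N := 4 * n + 2) (by omega)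
  push_cast at h
  refine ⟨a + 2 * c, a - 2 * c, b, ha.add_even (even_two_mul c), ha.sub_even (even_two_mul c),
    hb, ?_⟩
  push_cast
  linear_combination -2 * h

lemma oddTernaryRepresents_one_one_four (n : ℕ) : OddTernaryRepresents 1 1 4 n := by
  obtain ⟨a, b, c, ha, hb, h⟩ :=
    exists_odd_sq_add_odd_sq_add_four_mul_sq (N := 8 * n + 6) (by omega)
  push_cast at h
  refine ⟨a, b, c, ha, hb, ?_⟩
  have hx := a.sq_emod_sixteen_cases
  have hy := b.sq_emod_sixteen_cases
  have hz := c.sq_emod_sixteen_cases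
  rw [Int.odd_iff] at *
  push_cast
  omega

lemma oddTernaryRepresents_one_two_two (n : ℕ) : OddTernaryRepresents 1 2 2 n := by
  obtain ⟨a, b, c, ha, h⟩ :=
    exists_odd_sq_add_four_mul_sq_add_four_mul_sq (N := 8 * n + 5) (by omega)
  push_cast at h
  refine ⟨a, b + c, b - c, ha, ?_, ?_, ?_⟩
  iterate 2
    have hx := a.sq_emod_sixteen_cases
    have hy := b.sq_emod_sixteen_cases
    have hz := c.sq_emod_sixteen_cases
    rw [Int.odd_iff] at *
    omega
  push_cast
  linear_combination -h

lemma oddTernaryRepresents_one_two_four (n : ℕ) : OddTernaryRepresents 1 2 4 n := by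
  obtain ⟨a, b, y, ha, hb, h⟩ :=
    exists_odd_sq_add_odd_sq_add_four_mul_sq (N := 16 * n + 14) (by omega)
  rw [Int.odd_iff] at *
  obtain ⟨z, hz⟩ : ∃ z, b ^ 2 = (a - 4 * z) ^ 2 := by
    obtain h4 | h4 : (a - b) % 4 = 0 ∨ (a + b) % 4 = 0 := by omega
    · obtain ⟨z, hz⟩ := Int.dvd_of_emod_eq_zero h4
      exact ⟨z, by rw [← hz]; ring⟩
    · obtain ⟨z, hz⟩ := Int.dvd_of_emod_eq_zero h4
      exact ⟨z, by rw [← hz]; ring⟩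
  push_cast at h
  have h' : (a - 2 * z) ^ 2 + 2 * y ^ 2 + 4 * z ^ 2 = 8 * n + 7 := by linarith
  refine ⟨a - 2 * z, y, z, ?_⟩
  have hx := (a - 2 * z).sq_emod_sixteen_cases
  have hy := y.sq_emod_sixteen_cases
  have hz := z.sq_emod_sixteen_cases
  have hb2 := b.sq_emod_sixteen_cases
  have ha2 := a.sq_emod_sixteen_cases
  simp only [Int.odd_iff]
  push_cast
  omega

lemma exists_five_mul_of_five_dvd {a b c : ℤ} (h : (a ^ 2 + b ^ 2 + c ^ 2) % 5 = 0) :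
    ∃ x y z : ℤ, a ^ 2 + b ^ 2 + c ^ 2 = 5 * (x ^ 2 + y ^ 2 + 5 * z ^ 2) := by
  have key : ∀ a b c : ℤ, c % 5 = 0 → ((a - 2 * b) % 5 = 0 ∨ (a + 2 * b) % 5 = 0) →
      ∃ x y z : ℤ, a ^ 2 + b ^ 2 + c ^ 2 = 5 * (x ^ 2 + y ^ 2 + 5 * z ^ 2) := by
    rintro a b c hc (hab | hab) <;> obtain ⟨z, rfl⟩ := Int.dvd_of_emod_eq_zero hc <;>
      obtain ⟨y, hy⟩ := Int.dvd_of_emod_eq_zero hab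
    · obtain rfl : a = 2 * b + 5 * y := by linarith
      exact ⟨b + 2 * y, y, z, by ring⟩
    · obtain rfl : a = -2 * b + 5 * y := by linarith
      exact ⟨b - 2 * y, y, z, by ring⟩
  have sq : ∀ x : ℤ, x % 5 = 0 ∧ x ^ 2 % 5 = 0 ∨ (x % 5 = 1 ∨ x % 5 = 4) ∧ x ^ 2 % 5 = 1 ∨
      (x % 5 = 2 ∨ x % 5 = 3) ∧ x ^ 2 % 5 = 4 := by
    intro x
    obtain ⟨k, r, hr, rfl⟩ : ∃ k r : ℤ, (r = 0 ∨ r = 1 ∨ r = 2 ∨ r = 3 ∨ r = 4) ∧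
      x = 5 * k + r := ⟨x / 5, x % 5, by omega, by omega⟩
    rcases hr with rfl | rfl | rfl | rfl | rfl <;> ring_nf <;> omega
  have ha := sq a
  have hb := sq b
  have hc := sq c
  obtain h' | h' | h' :
      (c % 5 = 0 ∧ ((a - 2 * b) % 5 = 0 ∨ (a + 2 * b) % 5 = 0)) ∨
      (b % 5 = 0 ∧ ((a - 2 * c) % 5 = 0 ∨ (a + 2 * c) % 5 = 0)) ∨
      (a % 5 = 0 ∧ ((b - 2 * c) % 5 = 0 ∨ (b + 2 * c) % 5 = 0)) := by omega
  · exact key a b c h'.1 h'.2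
  · obtain ⟨x, y, z, h⟩ := key a c b h'.1 h'.2
    exact ⟨x, y, z, by rw [← h]; ring⟩
  · obtain ⟨x, y, z, h⟩ := key b c a h'.1 h'.2
    exact ⟨x, y, z, by rw [← h]; ring⟩

lemma oddTernaryRepresents_one_one_five (n : ℕ) : OddTernaryRepresents 1 1 5 n := by
  obtain ⟨a, b, c, h⟩ :=
    exists_sq_add_sq_add_sq_of_odd (N := 5 * (8 * n + 7)) (by omega) (by omega)
  push_cast at h
  obtain ⟨x, y, z, h'⟩ := exists_five_mul_of_five_dvd (a := a) (b := b) (c := c) (by omega)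
  refine ⟨x, y, z, ?_⟩
  have hx := x.sq_emod_sixteen_cases
  have hy := y.sq_emod_sixteen_cases
  have hz := z.sq_emod_sixteen_cases
  simp only [Int.odd_iff]
  push_cast
  omega

lemma oddTernaryRepresents_one_two_three (n : ℕ) : OddTernaryRepresents 1 2 3 n := by
  obtain ⟨a, b, c, h⟩ :=
    exists_sq_add_sq_add_sq_of_odd (N := 3 * (4 * n + 3)) (by omega) (by omega)
  push_cast at h
  obtain ⟨b, p, q, h⟩ : ∃ b p q : ℤ,
      3 * (4 * (n : ℤ) + 3) = (b + 3 * p) ^ 2 + b ^ 2 + (b - 3 * q) ^ 2 := by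
    have key : ∀ a b c : ℤ, a % 3 = b % 3 → c % 3 = b % 3 →
        3 * (4 * (n : ℤ) + 3) = a ^ 2 + b ^ 2 + c ^ 2 → ∃ b p q : ℤ,
        3 * (4 * (n : ℤ) + 3) = (b + 3 * p) ^ 2 + b ^ 2 + (b - 3 * q) ^ 2 := by
      intro a b c hab hcb h
      obtain ⟨p, hp⟩ := Int.dvd_of_emod_eq_zero (Int.emod_eq_emod_iff_emod_sub_eq_zero.1 hab)
      obtain ⟨q, hq⟩ := Int.dvd_of_emod_eq_zero (Int.emod_eq_emod_iff_emod_sub_eq_zero.1 hcb)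
      refine ⟨b, p, -q, ?_⟩
      rw [h, ← hp, mul_neg, ← hq]
      ring
    have ha := a.sq_emod_three_cases
    have hb := b.sq_emod_three_cases
    have hc := c.sq_emod_three_cases
    obtain h' | h' : (a % 3 = 0 ∧ b % 3 = 0 ∧ c % 3 = 0) ∨
        (a % 3 ≠ 0 ∧ b % 3 ≠ 0 ∧ c % 3 ≠ 0) := by omega
    · exact key a b c (by omega) (by omega) h
    · obtain ⟨a', ha', ha3⟩ := Int.exists_sq_eq_and_emod_three_eq_one h'.1
      obtain ⟨b', hb', hb3⟩ := Int.exists_sq_eq_and_emod_three_eq_one h'.2.1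
      obtain ⟨c', hc', hc3⟩ := Int.exists_sq_eq_and_emod_three_eq_one h'.2.2
      exact key a' b' c' (by omega) (by omega) (by rw [ha', hb', hc', h])
  obtain ⟨y, hy⟩ : ∃ y, y = b + p - q := ⟨_, rfl⟩
  have h' : 4 * (n : ℤ) + 3 = y ^ 2 + 2 * (p ^ 2 + p * q + q ^ 2) := by
    rw [hy]; linarith
  have hy2 := y.sq_emod_sixteen_cases
  obtain ⟨x, z, hx, hz, hxz⟩ := exists_odd_sq_add_three_mul_sq (p := p) (q := q)
    (by rw [Int.odd_iff]; generalize p ^ 2 + p * q + q ^ 2 = F at *; omega)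
  refine ⟨x, y, z, hx, by rw [Int.odd_iff]; omega, hz, ?_⟩
  push_cast
  linarith

lemma oddTernaryRepresents_one_three_six {n : ℕ} (hn : n % 3 ≠ 2) :
    OddTernaryRepresents 1 3 6 n := by
  obtain ⟨a, b, c, h⟩ :=
    exists_sq_add_sq_add_sq_of_odd (N := 4 * n + 5) (by omega) (by omega)
  push_cast at h
  obtain ⟨b, c, y, h⟩ : ∃ b c y : ℤ,
      4 * (n : ℤ) + 5 = (3 * y - b - c) ^ 2 + b ^ 2 + c ^ 2 := by
    have key : ∀ a b c : ℤ, (a + b + c) % 3 = 0 →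
        4 * (n : ℤ) + 5 = a ^ 2 + b ^ 2 + c ^ 2 → ∃ b c y : ℤ,
        4 * (n : ℤ) + 5 = (3 * y - b - c) ^ 2 + b ^ 2 + c ^ 2 := by
      intro a b c habc h
      obtain ⟨y, hy⟩ := Int.dvd_of_emod_eq_zero habc
      exact ⟨b, c, y, by rw [h, ← hy]; ring⟩
    have ha := a.sq_emod_three_cases
    have hb := b.sq_emod_three_cases
    have hc := c.sq_emod_three_cases
    obtain h' | h' | h' | h' : (a + b + c) % 3 = 0 ∨ (-a + b + c) % 3 = 0 ∨
        (a - b + c) % 3 = 0 ∨ (a + b - c) % 3 = 0 := by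
      have ha3 : a % 3 = 0 ∨ a % 3 = 1 ∨ a % 3 = 2 := by omega
      have hb3 : b % 3 = 0 ∨ b % 3 = 1 ∨ b % 3 = 2 := by omega
      have hc3 : c % 3 = 0 ∨ c % 3 = 1 ∨ c % 3 = 2 := by omega
      rcases ha3 with ha3 | ha3 | ha3 <;> rcases hb3 with hb3 | hb3 | hb3 <;>
        rcases hc3 with hc3 | hc3 | hc3 <;> omega
    · exact key a b c h' h
    · exact key (-a) b c h' (by rw [h]; ring)
    · exact key a (-b) c h' (by rw [h]; ring)
    · exact key a b (-c) h' (by rw [h]; ring)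
  have h' : 4 * (n : ℤ) + 5 =
      3 * y ^ 2 + 2 * ((y - c) ^ 2 + (y - c) * (y - b) + (y - b) ^ 2) := by
    rw [h]; ring
  have hy2 := y.sq_emod_sixteen_cases
  obtain ⟨x, z, hx, hz, hxz⟩ := exists_odd_sq_add_three_mul_sq (p := y - c) (q := y - b)
    (by
      rw [Int.odd_iff]
      generalize (y - c) ^ 2 + (y - c) * (y - b) + (y - b) ^ 2 = F at *
      omega)
  refine ⟨x, z, y, hx, hz, by rw [Int.odd_iff]; omega, ?_⟩
  push_cast
  linarith

lemma oddTernaryRepresents_one_one_eight {n : ℕ} (hn : n % 2 = 0) :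
    OddTernaryRepresents 1 1 8 n := by
  obtain ⟨a, b, c, ha, h⟩ :=
    exists_odd_sq_add_four_mul_sq_add_four_mul_sq (N := 4 * n + 5) (by omega)
  push_cast at h
  obtain ⟨b, c, hc, h⟩ : ∃ b c : ℤ, Odd c ∧ 4 * (n : ℤ) + 5 = a ^ 2 + 4 * b ^ 2 + 4 * c ^ 2 := by
    have ha2 := a.sq_emod_sixteen_cases
    have hb2 := b.sq_emod_sixteen_cases
    have hc2 := c.sq_emod_sixteen_cases
    rw [Int.odd_iff] at ha
    obtain h' | h' : b % 2 = 1 ∨ c % 2 = 1 := by omega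
    · exact ⟨c, b, Int.odd_iff.2 h', by rw [h]; ring⟩
    · exact ⟨b, c, Int.odd_iff.2 h', h⟩
  refine ⟨a + 2 * b, a - 2 * b, c, ha.add_even (even_two_mul b), ha.sub_even (even_two_mul b),
    hc, ?_⟩
  push_cast
  linear_combination -2 * h

lemma oddTernaryRepresents_one_one_three {n : ℕ} (hn : n % 3 ≠ 2) :
    OddTernaryRepresents 1 1 3 n := by
  obtain ⟨x, y, z, h⟩ := exists_sq_add_sq_add_three_mul_sq (N := 8 * n + 5) (by omega) (by omega)
  push_cast at h
  have key : ∀ x y z : ℤ, Odd x → (y % 2 = 0 ∧ z % 2 = 0) →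
      8 * (n : ℤ) + 5 = x ^ 2 + y ^ 2 + 3 * z ^ 2 → OddTernaryRepresents 1 1 3 n := by
    rintro x y z hx ⟨hy, hz⟩ h
    obtain ⟨p, rfl⟩ := Int.dvd_of_emod_eq_zero hy
    obtain ⟨q, rfl⟩ := Int.dvd_of_emod_eq_zero hz
    refine ⟨x, p + 3 * q, p - q, hx, ?_, ?_, by push_cast; linarith⟩
    all_goals
      have hx2 := x.sq_emod_sixteen_cases
      have hp2 := p.sq_emod_sixteen_cases
      have hq2 := q.sq_emod_sixteen_cases
      rw [mul_pow, mul_pow] at h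
      rw [Int.odd_iff] at *
      omega
  have hx := x.sq_emod_sixteen_cases
  have hy := y.sq_emod_sixteen_cases
  have hz := z.sq_emod_sixteen_cases
  obtain ⟨h1, h2, h3⟩ | ⟨h1, h2⟩ | ⟨h1, h2⟩ : (x % 2 = 1 ∧ y % 2 = 1 ∧ z % 2 = 1) ∨
      (x % 2 = 1 ∧ y % 2 = 0 ∧ z % 2 = 0) ∨ (y % 2 = 1 ∧ x % 2 = 0 ∧ z % 2 = 0) := by omega
  · refine ⟨x, y, z, Int.odd_iff.2 h1, Int.odd_iff.2 h2, Int.odd_iff.2 h3, ?_⟩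
    push_cast
    linarith
  · exact key x y z (Int.odd_iff.2 h1) h2 h
  · exact key y x z (Int.odd_iff.2 h1) h2 (by rw [h]; ring)

lemma oddQuaternaryRepresents_one_one_three_three (n : ℕ) :
    OddQuaternaryRepresents 1 1 3 3 n := by
  induction n using Nat.strong_induction_on with
  | _ n ih =>
    by_cases hn : n % 3 = 2
    · obtain ⟨m, rfl⟩ : ∃ m, n = 3 * m + 2 := ⟨n / 3, by omega⟩
      obtain ⟨x, y, z, w, hx, hy, hz, hw, h⟩ := ih m (by omega)
      have h3 : Odd (3 : ℤ) := by decide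
      refine ⟨3 * z, 3 * w, x, y, h3.mul hz, h3.mul hw, hx, hy, ?_⟩
      push_cast at h ⊢
      linear_combination 3 * h
    · obtain ⟨x, y, z, hx, hy, hz, h⟩ := oddTernaryRepresents_one_one_three hn
      refine ⟨x, y, z, 1, hx, hy, hz, odd_one, ?_⟩
      push_cast at h ⊢
      linear_combination h

lemma oddQuaternaryRepresents_one_one_three_six (n : ℕ) :
    OddQuaternaryRepresents 1 1 3 6 n := by
  by_cases hn : n % 3 = 2
  · obtain ⟨m, rfl⟩ : ∃ m, n = m + 1 := ⟨n - 1, by omega⟩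
    obtain ⟨x, y, z, hx, hy, hz, h⟩ := oddTernaryRepresents_one_three_six (n := m) (by omega)
    refine ⟨x, 3, y, z, hx, by decide, hy, hz, ?_⟩
    push_cast at h ⊢
    linear_combination h
  · obtain ⟨x, y, z, hx, hy, hz, h⟩ := oddTernaryRepresents_one_three_six hn
    refine ⟨x, 1, y, z, hx, odd_one, hy, hz, ?_⟩
    push_cast at h ⊢
    linear_combination h

lemma oddQuaternaryRepresents_one_one_three_seven (n : ℕ) :
    OddQuaternaryRepresents 1 1 3 7 n := by
  by_cases hn : n % 3 = 2
  · obtain rfl | rfl | h7 : n = 2 ∨ n = 5 ∨ 7 ≤ n := by omega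
    · exact ⟨3, 3, 1, 1, by decide, by decide, by decide, by decide, by norm_num⟩
    · exact ⟨3, 3, 3, 1, by decide, by decide, by decide, by decide, by norm_num⟩
    · obtain ⟨m, rfl⟩ : ∃ m, n = m + 7 := ⟨n - 7, by omega⟩
      obtain ⟨x, y, z, hx, hy, hz, h⟩ := oddTernaryRepresents_one_one_three (n := m) (by omega)
      refine ⟨x, y, z, 3, hx, hy, hz, by decide, ?_⟩
      push_cast at h ⊢
      linear_combination h
  · obtain ⟨x, y, z, hx, hy, hz, h⟩ := oddTernaryRepresents_one_one_three hn
    refine ⟨x, y, z, 1, hx, hy, hz, odd_one, ?_⟩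
    push_cast at h ⊢
    linear_combination h

lemma oddQuaternaryRepresents_one_one_three_eight (n : ℕ) :
    OddQuaternaryRepresents 1 1 3 8 n := by
  by_cases hn : n % 2 = 0
  · obtain ⟨x, y, z, hx, hy, hz, h⟩ := oddTernaryRepresents_one_one_eight hn
    refine ⟨x, y, 1, z, hx, hy, odd_one, hz, ?_⟩
    push_cast at h ⊢
    linear_combination h
  · obtain rfl | h3 : n = 1 ∨ 3 ≤ n := by omega
    · exact ⟨3, 1, 1, 1, by decide, by decide, by decide, by decide, by norm_num⟩
    · obtain ⟨m, rfl⟩ : ∃ m, n = m + 3 := ⟨n - 3, by omega⟩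
      obtain ⟨x, y, z, hx, hy, hz, h⟩ := oddTernaryRepresents_one_one_eight (n := m) (by omega)
      refine ⟨x, y, 3, z, hx, hy, by decide, hz, ?_⟩
      push_cast at h ⊢
      linear_combination h

end OddSquares

section Escalation

variable {ι : Type*} [Fintype ι] [DecidableEq ι]

/-- The diagonal form with coefficients `b` represents `8 n + ∑ i ∈ s, b i` when restricted to
the coordinates in `s`, with odd values of the variables. -/
def OddRepresentsOn (b : ι → ℕ) (s : Finset ι) (n : ℕ) : Prop :=
  ∃ x : ι → ℤ, (∀ i, Odd (x i)) ∧ ∑ i ∈ s, (b i : ℤ) * x i ^ 2 = 8 * n + ∑ i ∈ s, (b i : ℤ)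

lemma OddRepresentsOn.univ {b : ι → ℕ} {s : Finset ι} {n : ℕ} (h : OddRepresentsOn b s n) :
    OddRepresentsOn b Finset.univ n := by
  obtain ⟨x, hx, h⟩ := h
  refine ⟨fun i ↦ if i ∈ s then x i else 1, fun i ↦ ?_, ?_⟩
  · dsimp only
    split_ifs
    exacts [hx i, odd_one]
  · rw [← Finset.sum_add_sum_compl s, ← Finset.sum_add_sum_compl s fun i ↦ (b i : ℤ), ← add_assoc,
      ← h]
    congr 1
    · exact Finset.sum_congr rfl fun i hi ↦ by simp [hi]
    · exact Finset.sum_congr rfl fun i hi ↦ by simp [Finset.mem_compl.1 hi]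

lemma Int.sq_cases_of_odd {x : ℤ} (hx : Odd x) :
    x ^ 2 = 1 ∨ x ^ 2 = 9 ∨ x ^ 2 = 25 ∨ x ^ 2 = 49 ∨ 81 ≤ x ^ 2 := by
  rw [← sq_abs]
  have h : |x| % 2 = 1 := Int.odd_iff.1 (odd_abs.2 hx)
  obtain h | h | h | h | h : |x| = 1 ∨ |x| = 3 ∨ |x| = 5 ∨ |x| = 7 ∨ 9 ≤ |x| := by
    have := abs_nonneg x
    omega
  iterate 4 simp [h]
  have : 9 ^ 2 ≤ |x| ^ 2 := by gcongr
  omega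

/-- If `8 n + ∑ i, b i` is represented but not already on `s`, some coefficient off `s` is at
most `n`. -/
lemma OddRepresentsOn.exists_le {b : ι → ℕ} {n : ℕ} (h : OddRepresentsOn b Finset.univ n)
    {s : Finset ι} (hs : ¬ OddRepresentsOn b s n) : ∃ i ∉ s, b i ≤ n := by
  by_contra! hlt
  obtain ⟨x, hx, h⟩ := h
  rw [← Finset.sum_add_sum_compl s, ← Finset.sum_add_sum_compl s fun i ↦ (b i : ℤ)] at h
  have hle : ∀ i, (b i : ℤ) * 1 ≤ b i * x i ^ 2 := fun i ↦ by
    gcongr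
    have := Int.sq_cases_of_odd (hx i)
    omega
  simp only [mul_one] at hle
  refine hs ⟨x, hx, ?_⟩
  suffices hc : ∑ i ∈ sᶜ, (b i : ℤ) * x i ^ 2 = ∑ i ∈ sᶜ, (b i : ℤ) by linarith
  refine Finset.sum_congr rfl fun i hi ↦ ?_
  have h1 : ∑ j ∈ s, (b j : ℤ) ≤ ∑ j ∈ s, (b j : ℤ) * x j ^ 2 :=
    Finset.sum_le_sum fun j _ ↦ hle j
  have h2 : (b i : ℤ) * x i ^ 2 - b i ≤ ∑ j ∈ sᶜ, ((b j : ℤ) * x j ^ 2 - b j) :=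
    Finset.single_le_sum (f := fun j ↦ (b j : ℤ) * x j ^ 2 - b j)
      (fun j _ ↦ sub_nonneg.2 (hle j)) hi
  rw [Finset.sum_sub_distrib] at h2
  have h3 : (n : ℤ) < b i := by exact_mod_cast hlt i (Finset.mem_compl.1 hi)
  have h4 : x i ^ 2 = 1 ∨ 9 ≤ x i ^ 2 := by
    have := Int.sq_cases_of_odd (hx i)
    omega
  rcases h4 with h4 | h4
  · rw [h4, mul_one]
  · nlinarith

lemma OddTernaryRepresents.univ {b : ι → ℕ} {i j k : ι} (hij : j ≠ i) (hik : k ≠ i)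
    (hjk : k ≠ j) {n : ℕ} (h : OddTernaryRepresents (b i) (b j) (b k) n) :
    OddRepresentsOn b Finset.univ n := by
  obtain ⟨x, y, z, hx, hy, hz, h⟩ := h
  apply OddRepresentsOn.univ (s := {i, j, k})
  refine ⟨fun l ↦ if l = i then x else if l = j then y else z, fun l ↦ ?_, ?_⟩
  · dsimp only
    split_ifs <;> assumption
  · have h1 : i ∉ ({j, k} : Finset ι) := by simp [hij.symm, hik.symm]
    have h2 : j ∉ ({k} : Finset ι) := by simp [hjk.symm]
    rw [Finset.sum_insert h1, Finset.sum_insert h1, Finset.sum_insert h2, Finset.sum_insert h2]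
    simp only [Finset.sum_singleton, if_true, if_neg hij, if_neg hik, if_neg hjk]
    linarith

lemma OddQuaternaryRepresents.univ {b : ι → ℕ} {i j k l : ι} (hij : j ≠ i) (hik : k ≠ i)
    (hjk : k ≠ j) (hil : l ≠ i) (hjl : l ≠ j) (hkl : l ≠ k) {n : ℕ}
    (h : OddQuaternaryRepresents (b i) (b j) (b k) (b l) n) :
    OddRepresentsOn b Finset.univ n := by
  obtain ⟨x, y, z, w, hx, hy, hz, hw, h⟩ := h
  apply OddRepresentsOn.univ (s := {i, j, k, l})
  refine ⟨fun m ↦ if m = i then x else if m = j then y else if m = k then z else w,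
    fun m ↦ ?_, ?_⟩
  · dsimp only
    split_ifs <;> assumption
  · have h1 : i ∉ ({j, k, l} : Finset ι) := by simp [hij.symm, hik.symm, hil.symm]
    have h2 : j ∉ ({k, l} : Finset ι) := by simp [hjk.symm, hjl.symm]
    have h3 : k ∉ ({l} : Finset ι) := by simp [hkl.symm]
    rw [Finset.sum_insert h1, Finset.sum_insert h1, Finset.sum_insert h2, Finset.sum_insert h2,
      Finset.sum_insert h3, Finset.sum_insert h3]
    simp only [Finset.sum_singleton, if_true, if_neg hij, if_neg hik, if_neg hjk, if_neg hil,
      if_neg hjl, if_neg hkl]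
    linarith

lemma oddRepresentsOn_univ_of_one_two_four_five_eight {b : ι → ℕ} (hb : ∀ i, 0 < b i)
    (h1 : OddRepresentsOn b Finset.univ 1) (h2 : OddRepresentsOn b Finset.univ 2)
    (h4 : OddRepresentsOn b Finset.univ 4) (h5 : OddRepresentsOn b Finset.univ 5)
    (h8 : OddRepresentsOn b Finset.univ 8) (n : ℕ) : OddRepresentsOn b Finset.univ n := by
  obtain ⟨i, -, hi⟩ := h1.exists_le (s := ∅) (by rintro ⟨x, -, h⟩; simp at h)
  have hbi : b i = 1 := by have := hb i; omega
  obtain ⟨j, hj, hbj⟩ := h2.exists_le (s := {i}) (by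
    rintro ⟨x, hx, h⟩
    simp only [Finset.sum_singleton, hbi] at h
    have := Int.sq_cases_of_odd (hx i)
    push_cast at h
    omega)
  rw [Finset.mem_singleton] at hj
  have hi_notMem : i ∉ ({j} : Finset ι) := by simpa using Ne.symm hj
  obtain hbj | hbj : b j = 1 ∨ b j = 2 := by have := hb j; omega
  · obtain ⟨k, hk, hbk⟩ := h5.exists_le (s := {i, j}) (by
      rintro ⟨x, hx, h⟩
      simp only [Finset.sum_insert hi_notMem, Finset.sum_singleton, hbi, hbj] at h
      have := Int.sq_cases_of_odd (hx i)
      have := Int.sq_cases_of_odd (hx j)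
      push_cast at h
      omega)
    simp only [Finset.mem_insert, Finset.mem_singleton, not_or] at hk
    have ternary {m : ι} (hmi : m ≠ i) (hmj : m ≠ j)
        (h : b m = 1 ∨ b m = 2 ∨ b m = 4 ∨ b m = 5) : OddRepresentsOn b Finset.univ n := by
      refine OddTernaryRepresents.univ hj hmi hmj ?_
      rw [hbi, hbj]
      rcases h with h | h | h | h <;> rw [h]
      exacts [oddTernaryRepresents_one_one_one n, oddTernaryRepresents_one_one_two n,
        oddTernaryRepresents_one_one_four n, oddTernaryRepresents_one_one_five n]
    by_cases hbk3 : b k = 3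
    · have hi_notMem' : i ∉ ({j, k} : Finset ι) := by simp [Ne.symm hj, Ne.symm hk.1]
      have hj_notMem : j ∉ ({k} : Finset ι) := by simp [Ne.symm hk.2]
      obtain ⟨l, hl, hbl⟩ := h8.exists_le (s := {i, j, k}) (by
        rintro ⟨x, hx, h⟩
        simp only [Finset.sum_insert hi_notMem', Finset.sum_insert hj_notMem,
          Finset.sum_singleton, hbi, hbj, hbk3] at h
        have := Int.sq_cases_of_odd (hx i)
        have := Int.sq_cases_of_odd (hx j)
        have := Int.sq_cases_of_odd (hx k)
        push_cast at h
        omega)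
      simp only [Finset.mem_insert, Finset.mem_singleton, not_or] at hl
      obtain hbl | hbl : (b l = 1 ∨ b l = 2 ∨ b l = 4 ∨ b l = 5) ∨
          (b l = 3 ∨ b l = 6 ∨ b l = 7 ∨ b l = 8) := by have := hb l; omega
      · exact ternary hl.1 hl.2.1 hbl
      · refine OddQuaternaryRepresents.univ hj hk.1 hk.2 hl.1 hl.2.1 hl.2.2 ?_
        rw [hbi, hbj, hbk3]
        rcases hbl with h | h | h | h <;> rw [h]
        exacts [oddQuaternaryRepresents_one_one_three_three n,
          oddQuaternaryRepresents_one_one_three_six n,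
          oddQuaternaryRepresents_one_one_three_seven n,
          oddQuaternaryRepresents_one_one_three_eight n]
    · exact ternary hk.1 hk.2 (by have := hb k; omega)
  · obtain ⟨k, hk, hbk⟩ := h4.exists_le (s := {i, j}) (by
      rintro ⟨x, hx, h⟩
      simp only [Finset.sum_insert hi_notMem, Finset.sum_singleton, hbi, hbj] at h
      have := Int.sq_cases_of_odd (hx i)
      have := Int.sq_cases_of_odd (hx j)
      push_cast at h
      omega)
    simp only [Finset.mem_insert, Finset.mem_singleton, not_or] at hk
    obtain hbk | hbk : b k = 1 ∨ (b k = 2 ∨ b k = 3 ∨ b k = 4) := by have := hb k; omega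
    · refine OddTernaryRepresents.univ hk.1 hj (Ne.symm hk.2) ?_
      rw [hbi, hbj, hbk]
      exact oddTernaryRepresents_one_one_two n
    · refine OddTernaryRepresents.univ hj hk.1 hk.2 ?_
      rw [hbi, hbj]
      rcases hbk with h | h | h <;> rw [h]
      exacts [oddTernaryRepresents_one_two_two n, oddTernaryRepresents_one_two_three n,
        oddTernaryRepresents_one_two_four n]

end Escalation

/-- Kane's theorem: the diagonal form `Σ bᵢ xᵢ²` with all `xᵢ` odd represents
every integer `8n + S` (where `S = Σ bᵢ`) iff it represents
`8 + S, 16 + S, 32 + S, 40 + S` and `64 + S`. -/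
theorem odd_diagonal_form_represents_iff (k : ℕ) (hk : 0 < k)
    (b : Fin k → ℕ) (hb : ∀ i, 0 < b i) :
    (∀ n : ℕ, ∃ x : Fin k → ℤ, (∀ i, Odd (x i)) ∧
        ∑ i, (b i : ℤ) * x i ^ 2 = 8 * n + ∑ i, (b i : ℤ)) ↔
      (∀ j ∈ ({8, 16, 32, 40, 64} : Set ℕ), ∃ x : Fin k → ℤ, (∀ i, Odd (x i)) ∧
        ∑ i, (b i : ℤ) * x i ^ 2 = j + ∑ i, (b i : ℤ)) := by
  refine ⟨fun h j hj ↦ ?_, fun h n ↦ ?_⟩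
  · obtain ⟨m, rfl⟩ : ∃ m, j = 8 * m := by
      simp only [Set.mem_insert_iff, Set.mem_singleton_iff] at hj
      exact ⟨j / 8, by omega⟩
    simpa using h m
  · have key (m : ℕ) (hm : 8 * m ∈ ({8, 16, 32, 40, 64} : Set ℕ)) :
        OddRepresentsOn b Finset.univ m := by
      simpa [OddRepresentsOn] using h (8 * m) hm
    exact oddRepresentsOn_univ_of_one_two_four_five_eight hb (key 1 (by simp)) (key 2 (by simp))
      (key 4 (by simp)) (key 5 (by simp)) (key 8 (by simp)) n
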